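/- arXiv:2212.08402 — 11 statements merged into one kernel-verified Lean document; each statement's English description precedes it below -/
import Mathlib

section
/- Let V be a finite nonempty set, let con : V × V → ℝ be symmetric with con(u,v) ≥ 0 for all u,v and con(u,u) = 0, and suppose the graph on V whose edges are the pairs {u,v} with con(u,v) > 0 is connected. Fix an origin u₀ ∈ V and define the matrix Δ indexed by V by: Δ(u,u) = 1 + ∑_{w ∈ V} con(u,w) if u = u₀, Δ(u,u) = ∑_{w ∈ V} con(u,w) if u ≠ u₀, and Δ(u,v) = −con(u,v) if u ≠ v. Then Δ is a symmetric, strictly positive definite matrix (i.e., xᵀΔx > 0 for every nonzero x ∈ ℝ^V). -/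
open Matrix

/-- Summation by parts for the Laplacian of a symmetric conductance. -/
theorem sum_mul_sum_conductance_mul_sub {V : Type*} [Fintype V] (con : V → V → ℝ)
    (hsymm : ∀ u v, con u v = con v u) (x : V → ℝ) :
    2 * ∑ u, x u * ∑ w, con u w * (x u - x w) = ∑ u, ∑ w, con u w * (x u - x w) ^ 2 := by
  have h : ∑ u, ∑ w, x u * (con u w * (x u - x w)) =
      ∑ u, ∑ w, x w * (con u w * (x w - x u)) := by
    rw [Finset.sum_comm]
    exact Finset.sum_congr rfl fun u _ => Finset.sum_congr rfl fun w _ => by rw [hsymm]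
  have h' : ∑ u, x u * ∑ w, con u w * (x u - x w) =
      ∑ u, ∑ w, x u * (con u w * (x u - x w)) := by
    simp only [Finset.mul_sum]
  rw [two_mul, h']
  nth_rewrite 2 [h]
  simp only [← Finset.sum_add_distrib]
  refine Finset.sum_congr rfl fun u _ => Finset.sum_congr rfl fun w _ => ?_
  ring

/-- A row of a conductance Laplacian plus a unit mass at `u₀`, applied to a vector. -/
theorem mulVec_massive_laplacian {V : Type*} [Fintype V] [DecidableEq V] (con : V → V → ℝ)
    (hdiag : ∀ u, con u u = 0) (u₀ : V) (Δ : Matrix V V ℝ)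
    (hΔ : ∀ u v, Δ u v =
      if u = v then (if u = u₀ then 1 else 0) + ∑ w, con u w else - con u v)
    (x : V → ℝ) (u : V) :
    (Δ *ᵥ x) u = (if u = u₀ then x u else 0) + ∑ w, con u w * (x u - x w) := by
  have h : ∀ v, Δ u v * x v =
      (if u = v then ((if u = u₀ then 1 else 0) + ∑ w, con u w) * x v else 0) - con u v * x v := by
    intro v
    rw [hΔ]
    split_ifs <;> simp_all
  simp only [mulVec, dotProduct, h, Finset.sum_sub_distrib, Finset.sum_ite_eq, Finset.mem_univ,
    if_true, mul_sub, ← Finset.sum_mul]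
  split_ifs <;> ring

/-- The quadratic form of a conductance Laplacian plus a unit mass at `u₀`. -/
theorem dotProduct_mulVec_massive_laplacian {V : Type*} [Fintype V] [DecidableEq V]
    (con : V → V → ℝ) (hsymm : ∀ u v, con u v = con v u)
    (hdiag : ∀ u, con u u = 0) (u₀ : V) (Δ : Matrix V V ℝ)
    (hΔ : ∀ u v, Δ u v =
      if u = v then (if u = u₀ then 1 else 0) + ∑ w, con u w else - con u v)
    (x : V → ℝ) :
    x ⬝ᵥ (Δ *ᵥ x) = x u₀ ^ 2 + (∑ u, ∑ w, con u w * (x u - x w) ^ 2) / 2 := by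
  rw [← sum_mul_sum_conductance_mul_sub con hsymm]
  simp only [dotProduct, mulVec_massive_laplacian con hdiag u₀ Δ hΔ, mul_add,
    Finset.sum_add_distrib, mul_ite, mul_zero, Finset.sum_ite_eq', Finset.mem_univ, if_true]
  ring

/-- The matrix `Δ` built from a symmetric nonnegative conductance function on a finite
connected graph, with an extra `1` added at the diagonal entry of the origin `u₀`,
is symmetric and strictly positive definite. -/
theorem stmt0 {V : Type*} [Fintype V] [DecidableEq V] [Nonempty V]
    (con : V → V → ℝ)
    (hsymm : ∀ u v, con u v = con v u)
    (hnonneg : ∀ u v, 0 ≤ con u v)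
    (hdiag : ∀ u, con u u = 0)
    (hconn : ∀ u v : V, Relation.ReflTransGen (fun a b => 0 < con a b) u v)
    (u₀ : V)
    (Δ : Matrix V V ℝ)
    (hΔ : ∀ u v, Δ u v =
      if u = v then (if u = u₀ then 1 else 0) + ∑ w, con u w else - con u v) :
    Δ.PosDef := by
  refine PosDef.of_dotProduct_mulVec_pos ?_ fun x hx => ?_
  · ext u v
    rw [conjTranspose_apply, star_trivial, hΔ, hΔ]
    by_cases h : u = v
    · simp [h]
    · simp [h, Ne.symm h, hsymm u v]
  · rw [star_trivial, dotProduct_mulVec_massive_laplacian con hsymm hdiag u₀ Δ hΔ]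
    have hterm : ∀ u w, 0 ≤ con u w * (x u - x w) ^ 2 := fun u w =>
      mul_nonneg (hnonneg u w) (sq_nonneg _)
    have hrow : ∀ u, 0 ≤ ∑ w, con u w * (x u - x w) ^ 2 := fun u =>
      Finset.sum_nonneg fun w _ => hterm u w
    have hsum : 0 ≤ ∑ u, ∑ w, con u w * (x u - x w) ^ 2 := Finset.sum_nonneg fun u _ => hrow u
    by_contra! hle
    have hx₀ : x u₀ = 0 := by
      have := sq_nonneg (x u₀)
      exact pow_eq_zero_iff two_ne_zero |>.1 (by linarith)
    have hzero : ∑ u, ∑ w, con u w * (x u - x w) ^ 2 = 0 := by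
      have := sq_nonneg (x u₀)
      linarith
    have hedge : ∀ u w, 0 < con u w → x u = x w := by
      intro u w huw
      have hu := (Finset.sum_eq_zero_iff_of_nonneg fun u _ => hrow u).1 hzero u (Finset.mem_univ u)
      have hw := (Finset.sum_eq_zero_iff_of_nonneg fun w _ => hterm u w).1 hu w (Finset.mem_univ w)
      exact sub_eq_zero.1 (pow_eq_zero_iff two_ne_zero |>.1
        ((mul_eq_zero.1 hw).resolve_left huw.ne'))
    refine hx (funext fun v => ?_)
    have hv : x u₀ = x v := by
      induction hconn u₀ v with
      | refl => rfl
      | tail _ h ih => exact ih.trans (hedge _ _ h)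
    rw [← hv, hx₀, Pi.zero_apply]
end

section
/- Let (T, d) be a metric space and let ℓ > 0 be such that d(u,v) ≤ ℓ/2 for all u, v ∈ T. Then the function ρ(u,v) = d(u,v) − d(u,v)²/ℓ is again a metric on T. (In particular, on a circle of circumference ℓ with geodesic distance d_G, the function d_G(u,v) − d_G(u,v)²/ℓ is a metric; this is the resistance metric of a loop.) -/
theorem sub_sq_div_le_sub_sq_div {ℓ a c : ℝ} (hℓ : 0 < ℓ) (hac : a ≤ c) (hc : c ≤ ℓ / 2) :
    a - a ^ 2 / ℓ ≤ c - c ^ 2 / ℓ := by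
  have h : 0 ≤ (c - a) * (ℓ - a - c) / ℓ :=
    div_nonneg (mul_nonneg (by linarith) (by linarith)) hℓ.le
  have e : (c - a) * (ℓ - a - c) / ℓ = (c - c ^ 2 / ℓ) - (a - a ^ 2 / ℓ) := by
    field_simp
    ring
  linarith

theorem sub_sq_div_nonneg {ℓ a : ℝ} (hℓ : 0 < ℓ) (ha : 0 ≤ a) (haℓ : a ≤ ℓ / 2) :
    0 ≤ a - a ^ 2 / ℓ := by
  simpa using sub_sq_div_le_sub_sq_div hℓ ha haℓ

theorem sub_sq_div_eq_zero_iff {ℓ a : ℝ} (hℓ : 0 < ℓ) (haℓ : a ≤ ℓ / 2) :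
    a - a ^ 2 / ℓ = 0 ↔ a = 0 := by
  have e : a - a ^ 2 / ℓ = a * (ℓ - a) / ℓ := by
    field_simp
  have h : ℓ - a ≠ 0 := by linarith
  simp [e, h, hℓ.ne']

theorem sub_sq_div_le_add {ℓ a b c : ℝ} (hℓ : 0 < ℓ) (ha : 0 ≤ a) (hb : 0 ≤ b)
    (haℓ : a ≤ ℓ / 2) (hbℓ : b ≤ ℓ / 2) (hcℓ : c ≤ ℓ / 2) (hc : c ≤ a + b) :
    c - c ^ 2 / ℓ ≤ (a - a ^ 2 / ℓ) + (b - b ^ 2 / ℓ) := by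
  rcases le_total c a with hca | hac
  · linarith [sub_sq_div_le_sub_sq_div hℓ hca haℓ, sub_sq_div_nonneg hℓ hb hbℓ]
  rcases le_total c b with hcb | hbc
  · linarith [sub_sq_div_le_sub_sq_div hℓ hcb hbℓ, sub_sq_div_nonneg hℓ ha haℓ]
  have hsq : (a + b - c) * (a + b - c) ≤ a * b :=
    mul_le_mul (by linarith) (by linarith) (by linarith) ha
  have hlin : 0 ≤ (ℓ - 2 * c) * (a + b - c) := mul_nonneg (by linarith) (by linarith)
  have h : 0 ≤ (ℓ * (a + b - c) - (a ^ 2 + b ^ 2 - c ^ 2)) / ℓ :=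
    div_nonneg (by linarith [mul_nonneg ha hb]) hℓ.le
  have e : (ℓ * (a + b - c) - (a ^ 2 + b ^ 2 - c ^ 2)) / ℓ =
      (a - a ^ 2 / ℓ) + (b - b ^ 2 / ℓ) - (c - c ^ 2 / ℓ) := by
    field_simp
    ring
  linarith

/-- If `(T, d)` is a metric space with diameter at most `ℓ/2`, then
`ρ(u,v) = d(u,v) - d(u,v)²/ℓ` is again a metric on `T`: it is nonnegative, symmetric,
vanishes exactly on the diagonal, and satisfies the triangle inequality. -/
theorem stmt2 {T : Type*} [MetricSpace T] (ℓ : ℝ) (hℓ : 0 < ℓ)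
    (hd : ∀ u v : T, dist u v ≤ ℓ / 2) :
    (∀ u v : T, 0 ≤ dist u v - (dist u v) ^ 2 / ℓ) ∧
    (∀ u v : T, dist u v - (dist u v) ^ 2 / ℓ = dist v u - (dist v u) ^ 2 / ℓ) ∧
    (∀ u v : T, dist u v - (dist u v) ^ 2 / ℓ = 0 ↔ u = v) ∧
    (∀ u v w : T, dist u w - (dist u w) ^ 2 / ℓ ≤
      (dist u v - (dist u v) ^ 2 / ℓ) + (dist v w - (dist v w) ^ 2 / ℓ)) := by
  refine ⟨fun u v ↦ sub_sq_div_nonneg hℓ dist_nonneg (hd u v),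
    fun u v ↦ by rw [dist_comm], fun u v ↦ ?_, fun u v w ↦ ?_⟩
  · rw [sub_sq_div_eq_zero_iff hℓ (hd u v), dist_eq_zero]
  · exact sub_sq_div_le_add hℓ dist_nonneg dist_nonneg (hd u v) (hd v w) (hd u w)
      (dist_triangle u v w)
end

section
/- Let T be a set and let K : T × T → ℝ be a symmetric positive semidefinite kernel. Define the variogram γ(u,v) = K(u,u) + K(v,v) − 2K(u,v). Then for every s > 0, the kernel (u,v) ↦ exp(−s γ(u,v)) is symmetric positive semidefinite on T. -/
open scoped Matrix in
/-- Entrywise powers of a real positive semidefinite matrix are positive semidefinite. -/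
theorem Matrix.PosSemidef.map_pow {ι : Type*} [Fintype ι] {M : Matrix ι ι ℝ}
    (hM : M.PosSemidef) (k : ℕ) : (M.map (· ^ k)).PosSemidef := by
  induction k with
  | zero =>
    have h := Matrix.posSemidef_vecMulVec_self_star (fun _ : ι => (1 : ℝ))
    convert h using 1
    ext i j
    simp [Matrix.vecMulVec_apply]
  | succ k ih =>
    have h : M.map (· ^ (k + 1)) = M.map (· ^ k) ⊙ M := by
      ext i j
      simp [pow_succ]
    rw [h]
    exact ih.hadamard hM

/-- A real matrix is positive semidefinite iff it is symmetric with nonnegative quadratic form. -/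
theorem Matrix.posSemidef_real_iff_sum {ι : Type*} [Fintype ι] {M : Matrix ι ι ℝ} :
    M.PosSemidef ↔ (∀ i j, M i j = M j i) ∧
      ∀ a : ι → ℝ, 0 ≤ ∑ i, ∑ j, a i * a j * M i j := by
  rw [Matrix.posSemidef_iff_dotProduct_mulVec]
  refine and_congr ?_ (forall_congr' fun a => ?_)
  · simp only [Matrix.IsHermitian.ext_iff, star_trivial]
    exact forall_comm
  · simp only [dotProduct, Matrix.mulVec, Finset.mul_sum, star_trivial, Pi.star_apply]
    simp only [mul_assoc, mul_comm (M _ _)]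

/-- The entrywise exponential of a real positive semidefinite matrix has nonnegative quadratic
form. -/
theorem Matrix.PosSemidef.sum_mul_exp_nonneg {ι : Type*} [Fintype ι] {M : Matrix ι ι ℝ}
    (hM : M.PosSemidef) (a : ι → ℝ) :
    0 ≤ ∑ i, ∑ j, a i * a j * Real.exp (M i j) := by
  have h : HasSum (fun k : ℕ => ∑ i, ∑ j, a i * a j * (M i j ^ k / k.factorial))
      (∑ i, ∑ j, a i * a j * Real.exp (M i j)) := by
    refine hasSum_sum fun i _ => hasSum_sum fun j _ => HasSum.mul_left _ ?_
    rw [Real.exp_eq_exp_ℝ]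
    exact NormedSpace.expSeries_div_hasSum_exp (M i j)
  refine h.nonneg fun k => ?_
  have hk := (Matrix.posSemidef_real_iff_sum.mp (hM.map_pow k)).2 a
  simp only [← mul_div_assoc, ← Finset.sum_div]
  exact div_nonneg hk (Nat.cast_nonneg _)


/-- If `K` is a symmetric positive semidefinite kernel on `T` with variogram
`γ(u,v) = K(u,u) + K(v,v) - 2K(u,v)`, then for every `s > 0` the kernel
`(u,v) ↦ exp(-s γ(u,v))` is symmetric positive semidefinite. -/
theorem stmt3 {T : Type*} (K : T → T → ℝ)
    (hsymm : ∀ u v, K u v = K v u)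
    (hpsd : ∀ (n : ℕ) (u : Fin n → T) (a : Fin n → ℝ),
      0 ≤ ∑ i, ∑ j, a i * a j * K (u i) (u j))
    (s : ℝ) (hs : 0 < s) :
    (∀ u v, Real.exp (-(s * (K u u + K v v - 2 * K u v)))
      = Real.exp (-(s * (K v v + K u u - 2 * K v u)))) ∧
    ∀ (n : ℕ) (u : Fin n → T) (a : Fin n → ℝ),
      0 ≤ ∑ i, ∑ j, a i * a j *
        Real.exp (-(s * (K (u i) (u i) + K (u j) (u j) - 2 * K (u i) (u j)))) := by
  refine ⟨fun u v => by rw [hsymm u v, add_comm (K u u)], fun n u a => ?_⟩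
  have hM : (Matrix.of fun i j => 2 * s * K (u i) (u j)).PosSemidef := by
    refine Matrix.posSemidef_real_iff_sum.mpr ⟨fun i j => ?_, fun b => ?_⟩
    · simp only [Matrix.of_apply, hsymm (u i)]
    · simp only [Matrix.of_apply, mul_left_comm _ (2 * s), ← Finset.mul_sum]
      exact mul_nonneg (by positivity) (hpsd n u b)
  refine (hM.sum_mul_exp_nonneg fun i => a i * Real.exp (-(s * K (u i) (u i)))).trans_eq ?_
  refine Finset.sum_congr rfl fun i _ => Finset.sum_congr rfl fun j _ => ?_
  rw [Matrix.of_apply, mul_mul_mul_comm, mul_assoc (a i * a j), ← Real.exp_add, ← Real.exp_add]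
  ring_nf
end

section
/- Let T₁ and T₂ be sets with T₁ ∩ T₂ = {o} and T = T₁ ∪ T₂. Let k₁ and k₂ be symmetric positive semidefinite kernels on T₁ and T₂ respectively, with k₁(o,o) = k₂(o,o) = c > 0. Define k : T × T → ℝ by k(u,v) = k₁(u,v) if u,v ∈ T₁; k(u,v) = k₂(u,v) if u,v ∈ T₂; and k(u,v) = k₁(u,o) k₂(o,v)/c if u ∈ T₁ and v ∈ T₂ (and symmetrically if u ∈ T₂, v ∈ T₁). Then k is a well-defined symmetric positive semidefinite kernel on T. In particular, if d is a metric on T with d(u,v) = d(u,o) + d(o,v) for u ∈ T₁, v ∈ T₂ (a 1-sum), and exp(−s d) is positive semidefinite on each of T₁ and T₂, then exp(−s d) is positive semidefinite on T. -/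
/-- Cauchy-Schwarz inequality for a positive semidefinite kernel `K` on a set `S`, between a
finitely supported combination of points of `S` and a single point `o ∈ S`. -/
theorem sq_sum_mul_kernel_le {T : Type*} {S : Set T} {o : T} (ho : o ∈ S) {K : T → T → ℝ}
    (hsymm : ∀ u ∈ S, ∀ v ∈ S, K u v = K v u)
    (hpsd : ∀ (n : ℕ) (u : Fin n → T), (∀ i, u i ∈ S) →
      ∀ a : Fin n → ℝ, 0 ≤ ∑ i, ∑ j, a i * a j * K (u i) (u j))
    (hpos : 0 < K o o) {n : ℕ} {u : Fin n → T} (hu : ∀ i, u i ∈ S) (a : Fin n → ℝ) :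
    (∑ i, a i * K (u i) o) ^ 2 / K o o ≤ ∑ i, ∑ j, a i * a j * K (u i) (u j) := by
  set L := ∑ i, a i * K (u i) o with hL
  set Q := ∑ i, ∑ j, a i * a j * K (u i) (u j) with hQ
  have expand (t : ℝ) : 0 ≤ t * t * K o o + 2 * t * L + Q := by
    have h := hpsd (n + 1) (Fin.cons o u) (Fin.cases ho hu) (Fin.cons t a)
    have h₁ : ∑ j, t * a j * K o (u j) = t * L := by
      rw [hL, Finset.mul_sum]
      exact Finset.sum_congr rfl fun j _ => by rw [hsymm o ho (u j) (hu j)]; ring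
    have h₂ : ∑ i, a i * t * K (u i) o = t * L := by
      rw [hL, Finset.mul_sum]
      exact Finset.sum_congr rfl fun i _ => by ring
    simp only [Fin.sum_univ_succ, Fin.cons_zero, Fin.cons_succ, Finset.sum_add_distrib,
      h₁, h₂] at h
    linarith
  have h := expand (-L / K o o)
  have key : -L / K o o * (-L / K o o) * K o o + 2 * (-L / K o o) * L + Q
      = Q - L ^ 2 / K o o := by
    field_simp
    ring
  linarith


/-- Gluing lemma for positive semidefinite kernels on a 1-sum: if `T = T₁ ∪ T₂` with
`T₁ ∩ T₂ = {o}`, `k₁`, `k₂` are symmetric positive semidefinite kernels on `T₁`, `T₂`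
with `k₁(o,o) = k₂(o,o) = c > 0`, and `k` agrees with `k₁` on `T₁ × T₁`, with `k₂` on
`T₂ × T₂`, and equals `k₁(u,o) k₂(o,v)/c` for `u ∈ T₁`, `v ∈ T₂` (and symmetrically),
then `k` is a symmetric positive semidefinite kernel on all of `T`. -/
theorem stmt6 {T : Type*} (T₁ T₂ : Set T) (o : T)
    (hinter : T₁ ∩ T₂ = {o}) (hunion : T₁ ∪ T₂ = Set.univ)
    (c : ℝ) (hc : 0 < c)
    (k₁ k₂ k : T → T → ℝ)
    (hk₁symm : ∀ u ∈ T₁, ∀ v ∈ T₁, k₁ u v = k₁ v u)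
    (hk₂symm : ∀ u ∈ T₂, ∀ v ∈ T₂, k₂ u v = k₂ v u)
    (hk₁psd : ∀ (n : ℕ) (u : Fin n → T), (∀ i, u i ∈ T₁) →
      ∀ a : Fin n → ℝ, 0 ≤ ∑ i, ∑ j, a i * a j * k₁ (u i) (u j))
    (hk₂psd : ∀ (n : ℕ) (u : Fin n → T), (∀ i, u i ∈ T₂) →
      ∀ a : Fin n → ℝ, 0 ≤ ∑ i, ∑ j, a i * a j * k₂ (u i) (u j))
    (hk₁o : k₁ o o = c) (hk₂o : k₂ o o = c)
    (h11 : ∀ u ∈ T₁, ∀ v ∈ T₁, k u v = k₁ u v)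
    (h22 : ∀ u ∈ T₂, ∀ v ∈ T₂, k u v = k₂ u v)
    (h12 : ∀ u ∈ T₁, ∀ v ∈ T₂, k u v = k₁ u o * k₂ o v / c)
    (h21 : ∀ u ∈ T₂, ∀ v ∈ T₁, k u v = k₁ v o * k₂ o u / c) :
    (∀ u v, k u v = k v u) ∧
    ∀ (n : ℕ) (u : Fin n → T) (a : Fin n → ℝ),
      0 ≤ ∑ i, ∑ j, a i * a j * k (u i) (u j) := by
  classical
  have ho : o ∈ T₁ ∩ T₂ := hinter ▸ Set.mem_singleton o
  have cover (x : T) : x ∈ T₁ ∨ x ∈ T₂ := (Set.mem_union ..).mp (hunion ▸ Set.mem_univ x)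
  have mem₂ {x : T} (hx : x ∉ T₁) : x ∈ T₂ := (cover x).resolve_left hx
  refine ⟨fun u v => ?_, fun n u a => ?_⟩
  · rcases cover u with hu | hu <;> rcases cover v with hv | hv
    · rw [h11 u hu v hv, h11 v hv u hu, hk₁symm u hu v hv]
    · rw [h12 u hu v hv, h21 v hv u hu]
    · rw [h21 u hu v hv, h12 v hv u hu]
    · rw [h22 u hu v hv, h22 v hv u hu, hk₂symm u hu v hv]
  · let p : Fin n → T := fun i => if u i ∈ T₁ then u i else o
    let q : Fin n → T := fun i => if u i ∈ T₁ then o else u i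
    let b : Fin n → ℝ := fun i => if u i ∈ T₁ then a i else 0
    let d : Fin n → ℝ := fun i => if u i ∈ T₁ then 0 else a i
    have hp (i) : p i ∈ T₁ := by
      by_cases h : u i ∈ T₁ <;> simp [p, h, ho.1]
    have hq (i) : q i ∈ T₂ := by
      by_cases h : u i ∈ T₁
      · simp [q, h, ho.2]
      · simp [q, h, mem₂ h]
    have h₁ := sq_sum_mul_kernel_le ho.1 hk₁symm hk₁psd (hk₁o ▸ hc) hp b
    have h₂ := sq_sum_mul_kernel_le ho.2 hk₂symm hk₂psd (hk₂o ▸ hc) hq d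
    rw [hk₁o] at h₁
    rw [hk₂o] at h₂
    have split (i j) : a i * a j * k (u i) (u j) =
        b i * b j * k₁ (p i) (p j) + d i * d j * k₂ (q i) (q j)
          + (b i * k₁ (p i) o) * (d j * k₂ (q j) o) / c
          + (d i * k₂ (q i) o) * (b j * k₁ (p j) o) / c := by
      by_cases hi : u i ∈ T₁ <;> by_cases hj : u j ∈ T₁
      · simp [p, b, d, hi, hj, h11]
      · have hj₂ := mem₂ hj
        simp only [p, q, b, d, hi, hj, if_true, if_false, h12 _ hi _ hj₂,
          hk₂symm o ho.2 _ hj₂]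
        ring
      · have hi₂ := mem₂ hi
        simp only [p, q, b, d, hi, hj, if_true, if_false, h21 _ hi₂ _ hj,
          hk₂symm o ho.2 _ hi₂]
        ring
      · simp [q, b, d, hi, hj, h22 _ (mem₂ hi) _ (mem₂ hj)]
    simp only [split, Finset.sum_add_distrib, ← Finset.sum_div, ← Finset.sum_mul_sum]
    set L₁ := ∑ i, b i * k₁ (p i) o
    set L₂ := ∑ i, d i * k₂ (q i) o
    have hsq : 0 ≤ (L₁ + L₂) ^ 2 / c := by positivity
    have hexp : (L₁ + L₂) ^ 2 / c = L₁ ^ 2 / c + L₂ ^ 2 / c + L₁ * L₂ / c + L₂ * L₁ / c := by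
      ring
    linarith
end

section
/- Let f : [0,∞) → ℝ be completely monotone and non-constant. Then for every n ≥ 1 and all pairwise distinct real numbers x₁, …, xₙ, the n × n matrix with entries f(|xᵢ − xⱼ|) is (strictly) positive definite. -/
/-- A function `f : ℝ → ℝ` is completely monotone if it is nonnegative and continuous on
`[0,∞)`, infinitely differentiable on `(0,∞)`, and `(-1)ⁿ f⁽ⁿ⁾(t) ≥ 0` for all `t > 0`
and all `n ≥ 0`. -/
def CompletelyMonotone (f : ℝ → ℝ) : Prop :=
  (∀ t : ℝ, 0 ≤ t → 0 ≤ f t) ∧ ContinuousOn f (Set.Ici 0) ∧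
  ContDiffOn ℝ (⊤ : ℕ∞) f (Set.Ioi 0) ∧
  ∀ (n : ℕ) (t : ℝ), 0 < t → 0 ≤ (-1 : ℝ) ^ n * iteratedDeriv n f t

open MeasureTheory Set Filter Topology

/-- On a finite set, a nonnegative, convex, nonincreasing function is a nonnegative combination of
a constant and hinge functions `t ↦ (s - t)⁺`. -/
theorem exists_sum_hinge_eq {g : ℝ → ℝ} (hconv : ConvexOn ℝ (Ici 0) g)
    (hanti : AntitoneOn g (Ici 0)) (hnonneg : ∀ t, 0 ≤ t → 0 ≤ g t)
    (S : Finset ℝ) (hS : ∀ s ∈ S, 0 ≤ s) :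
    ∃ (μ : ℝ → ℝ) (c : ℝ), (∀ s, 0 ≤ μ s) ∧ 0 ≤ c ∧
      ∀ t ∈ S, g t = c + ∑ s ∈ S, μ s * max (s - t) 0 := by
  induction S using Finset.induction_on_min with
  | empty => exact ⟨0, 0, by simp, le_rfl, by simp⟩
  | insert a S ha ih =>
    have ha0 : 0 ≤ a := hS a (Finset.mem_insert_self a S)
    have haS : a ∉ S := fun h => (ha a h).false
    obtain ⟨μ, c, hμ, hc, hg⟩ := ih fun s hs => hS s (Finset.mem_insert_of_mem hs)
    rcases S.eq_empty_or_nonempty with rfl | hne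
    · exact ⟨0, g a, by simp, hnonneg a ha0, by simp⟩
    obtain ⟨b, hb, hbmin⟩ := S.exists_minimal hne
    replace hbmin : ∀ s ∈ S, b ≤ s := fun s hs => by
      by_contra! h
      exact absurd (hbmin hs h.le) (not_le.mpr h)
    have hab : a < b := ha b hb
    have hsum : ∀ t, ∑ s ∈ S.erase b, μ s * (s - t)
        = ∑ s ∈ S.erase b, μ s * s - t * ∑ s ∈ S.erase b, μ s := fun t => by
      rw [Finset.mul_sum, ← Finset.sum_sub_distrib]
      exact Finset.sum_congr rfl fun s _ => by ring
    have hgt : ∀ t ∈ S, (∀ s ∈ S.erase b, t ≤ s) →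
        g t = c + ∑ s ∈ S.erase b, μ s * (s - t) := fun t ht hle => by
      rw [hg t ht, ← Finset.add_sum_erase S _ hb, max_eq_right (sub_nonpos.2 (hbmin t ht)),
        mul_zero, zero_add]
      congr 1
      exact Finset.sum_congr rfl fun s hs => by rw [max_eq_left (sub_nonneg.2 (hle s hs))]
    have hgb := hgt b hb fun s hs => hbmin s (Finset.mem_of_mem_erase hs)
    have key : c + ∑ s ∈ S.erase b, μ s * (s - a) ≤ g a := by
      rcases (S.erase b).eq_empty_or_nonempty with he | hne'
      · rw [he, Finset.sum_empty] at hgb ⊢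
        rw [← hgb]
        exact hanti ha0 (ha0.trans hab.le) hab.le
      · obtain ⟨d, hd, hdmin⟩ := (S.erase b).exists_minimal hne'
        replace hdmin : ∀ s ∈ S.erase b, d ≤ s := fun s hs => by
          by_contra! h
          exact absurd (hdmin hs h.le) (not_le.mpr h)
        have hdS := Finset.mem_of_mem_erase hd
        have hbd : b < d := lt_of_le_of_ne (hbmin d hdS) (Finset.ne_of_mem_erase hd).symm
        have hgd := hgt d hdS hdmin
        have hslope := hconv.slope_mono_adjacent (mem_Ici.2 ha0)
          (mem_Ici.2 ((ha0.trans hab.le).trans hbd.le)) hab hbd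
        rw [hsum] at hgb hgd ⊢
        have hq : (g d - g b) / (d - b) = -∑ s ∈ S.erase b, μ s := by
          rw [div_eq_iff (sub_pos.2 hbd).ne', hgb, hgd]
          ring
        rw [hq, div_le_iff₀ (sub_pos.2 hab)] at hslope
        linarith
    set m := (g a - (c + ∑ s ∈ S.erase b, μ s * (s - a))) / (b - a) with hm
    have hm0 : 0 ≤ m := div_nonneg (sub_nonneg.2 key) (sub_pos.2 hab).le
    refine ⟨Function.update μ b m, c, fun s => ?_, hc, fun t ht => ?_⟩
    · rcases eq_or_ne s b with rfl | h
      · simpa using hm0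
      · simpa [h] using hμ s
    have herase : ∀ t, ∑ s ∈ S.erase b, Function.update μ b m s * max (s - t) 0
        = ∑ s ∈ S.erase b, μ s * max (s - t) 0 := fun t =>
      Finset.sum_congr rfl fun s hs => by
        rw [Function.update_of_ne (Finset.ne_of_mem_erase hs)]
    rw [Finset.sum_insert haS, ← Finset.add_sum_erase S _ hb, herase, Function.update_self]
    rcases Finset.mem_insert.1 ht with rfl | ht
    · have : ∑ s ∈ S.erase b, μ s * max (s - t) 0 = ∑ s ∈ S.erase b, μ s * (s - t) :=
        Finset.sum_congr rfl fun s hs => by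
          rw [max_eq_left (sub_nonneg.2 (ha s (Finset.mem_of_mem_erase hs)).le)]
      rw [this, sub_self, max_self, mul_zero, zero_add, max_eq_left (sub_pos.2 hab).le, hm,
        div_mul_cancel₀ _ (sub_pos.2 hab).ne']
      ring
    · rw [max_eq_right (sub_nonpos.2 (ha t ht).le), max_eq_right (sub_nonpos.2 (hbmin t ht)),
        hg t ht, ← Finset.add_sum_erase S _ hb, max_eq_right (sub_nonpos.2 (hbmin t ht))]
      ring

/-- The triangular kernel `(s - |x - y|)⁺` is the overlap of intervals of length `s`. -/
theorem integral_indicator_Ico_mul_indicator_Ico (s x y : ℝ) :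
    ∫ u, (Ico x (x + s)).indicator (1 : ℝ → ℝ) u * (Ico y (y + s)).indicator (1 : ℝ → ℝ) u
      = max (s - |x - y|) 0 := by
  have h : (fun u => (Ico x (x + s)).indicator (1 : ℝ → ℝ) u *
      (Ico y (y + s)).indicator (1 : ℝ → ℝ) u)
      = (Ico (max x y) (min (x + s) (y + s))).indicator 1 := by
    rw [← Ico_inter_Ico, inter_indicator_one]
    rfl
  rw [h, integral_indicator_one measurableSet_Ico, Real.volume_real_Ico, min_add_add_right]
  congr 1
  rcases le_total x y with hxy | hxy
  · rw [max_eq_right hxy, min_eq_left hxy, abs_of_nonpos (by linarith)]; ring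
  · rw [max_eq_left hxy, min_eq_right hxy, abs_of_nonneg (by linarith)]; ring

theorem integrable_indicator_Ico_mul_indicator_Ico (s x y : ℝ) :
    Integrable fun u =>
      (Ico x (x + s)).indicator (1 : ℝ → ℝ) u * (Ico y (y + s)).indicator (1 : ℝ → ℝ) u := by
  have h : (fun u => (Ico x (x + s)).indicator (1 : ℝ → ℝ) u *
      (Ico y (y + s)).indicator (1 : ℝ → ℝ) u)
      = (Ico x (x + s) ∩ Ico y (y + s)).indicator 1 := by
    rw [inter_indicator_one]
    rfl
  rw [h, integrable_indicator_iff (measurableSet_Ico.inter measurableSet_Ico)]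
  exact integrableOn_const (ne_top_of_le_ne_top measure_Ico_lt_top.ne
    (measure_mono inter_subset_left))

section Triangle

variable {ι : Type*} [Fintype ι] (x a : ι → ℝ) (s : ℝ)

theorem sq_sum_indicator_Ico (u : ℝ) :
    (∑ i, a i * (Ico (x i) (x i + s)).indicator (1 : ℝ → ℝ) u) ^ 2
      = ∑ i, ∑ j, a i * a j * ((Ico (x i) (x i + s)).indicator (1 : ℝ → ℝ) u *
        (Ico (x j) (x j + s)).indicator (1 : ℝ → ℝ) u) := by
  rw [sq, Finset.sum_mul_sum]
  exact Finset.sum_congr rfl fun i _ => Finset.sum_congr rfl fun j _ => by ring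

theorem integrable_sq_sum_indicator_Ico :
    Integrable fun u => (∑ i, a i * (Ico (x i) (x i + s)).indicator (1 : ℝ → ℝ) u) ^ 2 := by
  simp_rw [sq_sum_indicator_Ico]
  exact integrable_finsetSum _ fun i _ => integrable_finsetSum _ fun j _ =>
    (integrable_indicator_Ico_mul_indicator_Ico s (x i) (x j)).const_mul _

theorem sum_triangle_eq_integral :
    ∑ i, ∑ j, a i * a j * max (s - |x i - x j|) 0
      = ∫ u, (∑ i, a i * (Ico (x i) (x i + s)).indicator (1 : ℝ → ℝ) u) ^ 2 := by
  simp_rw [sq_sum_indicator_Ico]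
  have hint := fun i j => (integrable_indicator_Ico_mul_indicator_Ico s (x i) (x j)).const_mul
    (a i * a j)
  rw [integral_finsetSum _ fun i _ => integrable_finsetSum _ fun j _ => hint i j]
  refine Finset.sum_congr rfl fun i _ => ?_
  rw [integral_finsetSum _ fun j _ => hint i j]
  refine Finset.sum_congr rfl fun j _ => ?_
  rw [integral_const_mul, integral_indicator_Ico_mul_indicator_Ico]

theorem sum_triangle_nonneg : 0 ≤ ∑ i, ∑ j, a i * a j * max (s - |x i - x j|) 0 := by
  rw [sum_triangle_eq_integral]
  exact integral_nonneg fun u => sq_nonneg _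

variable {x a s}

theorem sum_triangle_pos (hx : Function.Injective x) (ha : a ≠ 0) (hs : 0 < s) :
    0 < ∑ i, ∑ j, a i * a j * max (s - |x i - x j|) 0 := by
  classical
  obtain ⟨k, hk⟩ := Function.ne_iff.1 ha
  obtain ⟨i, hi, hmin⟩ := (Finset.univ.filter fun i => a i ≠ 0).exists_min_image x
    ⟨k, by simpa using hk⟩
  have hai : a i ≠ 0 := by simpa using hi
  rw [sum_triangle_eq_integral, integral_pos_iff_support_of_nonneg (fun u => sq_nonneg _)
    (integrable_sq_sum_indicator_Ico x a s)]
  have hev : ∀ᶠ u in 𝓝[>] x i, u < x i + s ∧ ∀ j, a j ≠ 0 → j ≠ i → u < x j := by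
    refine Eventually.and (nhdsWithin_le_nhds (eventually_lt_nhds (lt_add_of_pos_right _ hs)))
      (eventually_all.2 fun j => ?_)
    by_cases hj : a j ≠ 0 ∧ j ≠ i
    · have hlt : x i < x j := lt_of_le_of_ne (hmin j (by simpa using hj.1)) (hx.ne hj.2.symm)
      filter_upwards [nhdsWithin_le_nhds (eventually_lt_nhds hlt)] with u hu _ _ using hu
    · exact Eventually.of_forall fun u h1 h2 => absurd ⟨h1, h2⟩ hj
  obtain ⟨v, hv, hsub⟩ := mem_nhdsGT_iff_exists_Ioo_subset.1 hev
  refine lt_of_lt_of_le (?_ : 0 < volume (Ioo (x i) v)) (measure_mono fun u hu => ?_)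
  · rw [Real.volume_Ioo, ENNReal.ofReal_pos]
    exact sub_pos.2 hv
  · obtain ⟨h1, h2⟩ := hsub hu
    rw [Function.mem_support, Finset.sum_eq_single i]
    · rw [indicator_of_mem (mem_Ico.2 ⟨hu.1.le, h1⟩)]
      simpa using hai
    · intro j _ hj
      by_cases haj : a j = 0
      · rw [haj, zero_mul]
      · rw [indicator_of_notMem fun h => (h2 j haj hj).not_ge h.1, mul_zero]
    · simp

end Triangle

/-- A Pólya-type criterion: a nonnegative, convex, nonincreasing, nonconstant function on `[0, ∞)`
gives a strictly positive definite kernel on the line. -/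
theorem posDef_of_convexOn_of_antitoneOn {ι : Type*} [Fintype ι] {g : ℝ → ℝ}
    (hconv : ConvexOn ℝ (Ici 0) g) (hanti : AntitoneOn g (Ici 0))
    (hnonneg : ∀ t, 0 ≤ t → 0 ≤ g t) (hnc : ∃ s t : ℝ, 0 ≤ s ∧ 0 ≤ t ∧ g s ≠ g t)
    {x : ι → ℝ} (hx : Function.Injective x) :
    (Matrix.of fun i j => g |x i - x j|).PosDef := by
  classical
  obtain ⟨t₀, ht₀, hlt⟩ : ∃ t, 0 ≤ t ∧ g t < g 0 := by
    obtain ⟨s, t, hs, ht, hst⟩ := hnc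
    rcases lt_or_gt_of_ne hst with h | h
    · exact ⟨s, hs, h.trans_le (hanti self_mem_Ici ht ht)⟩
    · exact ⟨t, ht, h.trans_le (hanti self_mem_Ici hs hs)⟩
  let S : Finset ℝ := insert 0 (insert t₀
    ((Finset.univ : Finset (ι × ι)).image fun p => |x p.1 - x p.2|))
  have hS : ∀ s ∈ S, 0 ≤ s := by
    intro s hs
    simp only [S, Finset.mem_insert, Finset.mem_image, Finset.mem_univ, true_and] at hs
    rcases hs with rfl | rfl | ⟨p, rfl⟩
    exacts [le_rfl, ht₀, abs_nonneg _]
  obtain ⟨μ, c, hμ, hc, hg⟩ := exists_sum_hinge_eq hconv hanti hnonneg S hS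
  obtain ⟨r, hrS, hr, hμr⟩ : ∃ r ∈ S, 0 < r ∧ 0 < μ r := by
    by_contra! h
    have hzero : g 0 = c := by
      rw [hg 0 (by simp [S]), Finset.sum_eq_zero, add_zero]
      intro s hs
      rcases (hS s hs).eq_or_lt with h0 | h0
      · simp [← h0]
      · rw [le_antisymm (h s hs h0) (hμ s), zero_mul]
    have hle : c ≤ g t₀ := by
      rw [hg t₀ (by simp [S])]
      exact le_add_of_nonneg_right (Finset.sum_nonneg fun s _ =>
        mul_nonneg (hμ s) (le_max_right _ _))
    linarith
  refine Matrix.PosDef.of_dotProduct_mulVec_pos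
    (Matrix.IsHermitian.ext fun i j => by simp [abs_sub_comm]) fun a ha => ?_
  have hform : star a ⬝ᵥ (Matrix.of fun i j => g |x i - x j|).mulVec a
      = c * (∑ i, a i) ^ 2 + ∑ s ∈ S, μ s * ∑ i, ∑ j, a i * a j * max (s - |x i - x j|) 0 := by
    have hentry : ∀ i j, g |x i - x j| = c + ∑ s ∈ S, μ s * max (s - |x i - x j|) 0 :=
      fun i j => hg _ (by
        simp only [S, Finset.mem_insert, Finset.mem_image, Finset.mem_univ, true_and]
        exact Or.inr (Or.inr ⟨(i, j), rfl⟩))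
    simp only [dotProduct, Matrix.mulVec, Matrix.of_apply, Pi.star_apply, star_trivial, hentry]
    rw [sq, Finset.sum_mul_sum]
    simp only [Finset.mul_sum, add_mul, mul_add, Finset.sum_add_distrib, Finset.sum_mul]
    congr 1
    · exact Finset.sum_congr rfl fun i _ => Finset.sum_congr rfl fun j _ => by ring
    · rw [Finset.sum_comm]
      simp_rw [Finset.sum_comm (t := S)]
      exact Finset.sum_congr rfl fun s _ => by
        rw [Finset.sum_comm]
        exact Finset.sum_congr rfl fun i _ => Finset.sum_congr rfl fun j _ => by ring
  rw [hform]
  refine add_pos_of_nonneg_of_pos (mul_nonneg hc (sq_nonneg _)) ?_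
  exact Finset.sum_pos' (fun s _ => mul_nonneg (hμ s) (sum_triangle_nonneg x a s))
    ⟨r, hrS, mul_pos hμr (sum_triangle_pos hx ha hr)⟩

namespace CompletelyMonotone

variable {f : ℝ → ℝ}

theorem antitoneOn (hf : CompletelyMonotone f) : AntitoneOn f (Ici 0) := by
  obtain ⟨-, hcont, hdiff, hsign⟩ := hf
  refine antitoneOn_of_deriv_nonpos (convex_Ici 0) hcont ?_ fun t ht => ?_
  · rw [interior_Ici]
    exact hdiff.differentiableOn (by simp)
  · rw [interior_Ici] at ht
    have := hsign 1 t ht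
    rw [iteratedDeriv_one] at this
    linarith

theorem convexOn (hf : CompletelyMonotone f) : ConvexOn ℝ (Ici 0) f := by
  obtain ⟨-, hcont, hdiff, hsign⟩ := hf
  refine convexOn_of_deriv2_nonneg (convex_Ici 0) hcont ?_ ?_ fun t ht => ?_
  · rw [interior_Ici]
    exact hdiff.differentiableOn (by simp)
  · rw [interior_Ici]
    exact (hdiff.deriv_of_isOpen (m := 1) isOpen_Ioi (WithTop.coe_le_coe.2 le_top)).differentiableOn
      (by simp)
  · rw [interior_Ici] at ht
    have := hsign 2 t ht
    rw [iteratedDeriv_eq_iterate] at this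
    linarith

end CompletelyMonotone

/-- If `f` is completely monotone and non-constant on `[0,∞)`, then for all `n ≥ 1` and
pairwise distinct reals `x₁, …, xₙ`, the matrix `(f(|xᵢ - xⱼ|))` is strictly positive
definite. -/
theorem stmt7 (f : ℝ → ℝ) (hf : CompletelyMonotone f)
    (hnc : ∃ s t : ℝ, 0 ≤ s ∧ 0 ≤ t ∧ f s ≠ f t)
    (n : ℕ) (hn : 1 ≤ n) (x : Fin n → ℝ) (hx : Function.Injective x) :
    (Matrix.of fun i j => f |x i - x j|).PosDef :=
  posDef_of_convexOn_of_antitoneOn hf.convexOn hf.antitoneOn hf.1 hnc hx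
end

section
/- For every α ∈ (0,1], the function f(t) = exp(−t^α) is completely monotone on [0,∞): f is nonnegative and continuous on [0,∞), infinitely differentiable on (0,∞), and (−1)ⁿ f⁽ⁿ⁾(t) ≥ 0 for every integer n ≥ 0 and every t > 0. -/
/-- The additive monoid generated by the functions `t ↦ c * t ^ β * exp (-t ^ α)` with `0 ≤ c`
and `β ≤ 0`. -/
def rpowMulExpCone (α : ℝ) : AddSubmonoid (ℝ → ℝ) :=
  AddSubmonoid.closure
    {g | ∃ c β : ℝ, 0 ≤ c ∧ β ≤ 0 ∧ g = fun t => c * t ^ β * Real.exp (-(t ^ α))}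

lemma mul_rpow_mul_exp_mem_rpowMulExpCone (α : ℝ) {c β : ℝ} (hc : 0 ≤ c) (hβ : β ≤ 0) :
    (fun t : ℝ => c * t ^ β * Real.exp (-(t ^ α))) ∈ rpowMulExpCone α :=
  AddSubmonoid.subset_closure ⟨c, β, hc, hβ, rfl⟩

lemma nonneg_of_mem_rpowMulExpCone {α : ℝ} {g : ℝ → ℝ} (hg : g ∈ rpowMulExpCone α)
    {t : ℝ} (ht : 0 < t) : 0 ≤ g t := by
  induction hg using AddSubmonoid.closure_induction with
  | mem g hg =>
    obtain ⟨c, β, hc, -, rfl⟩ := hg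
    positivity
  | zero => exact le_rfl
  | add g h _ _ ihg ihh => exact add_nonneg ihg ihh

/-- For `α ∈ [0,1]`, the cone is stable under `g ↦ -deriv g` on `(0,∞)`. -/
lemma exists_hasDerivAt_neg_of_mem_rpowMulExpCone {α : ℝ} (hα : 0 ≤ α) (hα1 : α ≤ 1)
    {g : ℝ → ℝ} (hg : g ∈ rpowMulExpCone α) :
    ∃ h ∈ rpowMulExpCone α, ∀ t : ℝ, 0 < t → HasDerivAt g (-h t) t := by
  induction hg using AddSubmonoid.closure_induction with
  | mem g hg =>
    obtain ⟨c, β, hc, hβ, rfl⟩ := hg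
    refine ⟨_, add_mem
      (mul_rpow_mul_exp_mem_rpowMulExpCone α (c := c * -β) (β := β - 1)
        (mul_nonneg hc (by linarith)) (by linarith))
      (mul_rpow_mul_exp_mem_rpowMulExpCone α (c := c * α) (β := β + (α - 1))
        (mul_nonneg hc hα) (by linarith)), fun t ht => ?_⟩
    have hpow := (Real.hasDerivAt_rpow_const (p := β) (Or.inl ht.ne')).const_mul c
    have hexp := (Real.hasDerivAt_rpow_const (p := α) (Or.inl ht.ne')).neg.exp
    refine (hpow.mul hexp).congr_deriv ?_
    simp only [Pi.add_apply, Pi.neg_apply, Real.rpow_add ht β (α - 1)]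
    ring
  | zero => exact ⟨0, zero_mem _, fun t _ => by simp⟩
  | add g₁ g₂ _ _ ih₁ ih₂ =>
    obtain ⟨h₁, hm₁, hd₁⟩ := ih₁
    obtain ⟨h₂, hm₂, hd₂⟩ := ih₂
    refine ⟨h₁ + h₂, add_mem hm₁ hm₂, fun t ht => ?_⟩
    exact ((hd₁ t ht).add (hd₂ t ht)).congr_deriv (neg_add _ _).symm

lemma exists_iteratedDeriv_eq_of_mem_rpowMulExpCone {α : ℝ} (hα : 0 ≤ α) (hα1 : α ≤ 1)
    {g : ℝ → ℝ} (hg : g ∈ rpowMulExpCone α) (n : ℕ) :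
    ∃ h ∈ rpowMulExpCone α, ∀ t : ℝ, 0 < t → iteratedDeriv n g t = (-1) ^ n * h t := by
  induction n with
  | zero => exact ⟨g, hg, fun t _ => by simp⟩
  | succ n ih =>
    obtain ⟨h, hm, hn⟩ := ih
    obtain ⟨k, hk, hd⟩ := exists_hasDerivAt_neg_of_mem_rpowMulExpCone hα hα1 hm
    refine ⟨k, hk, fun t ht => ?_⟩
    have heq : iteratedDeriv n g =ᶠ[nhds t] fun s => (-1) ^ n * h s := by
      filter_upwards [Ioi_mem_nhds ht] with s hs using hn s hs
    rw [iteratedDeriv_succ, heq.deriv_eq, ((hd t ht).const_mul _).deriv]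
    ring

/-- For every `α ∈ (0,1]`, the function `t ↦ exp(-t^α)` is completely monotone on `[0,∞)`. -/
theorem stmt8 (α : ℝ) (hα : 0 < α) (hα1 : α ≤ 1) :
    CompletelyMonotone (fun t : ℝ => Real.exp (-(t ^ α))) := by
  refine ⟨fun t _ => (Real.exp_pos _).le, ?_, ?_, fun n t ht => ?_⟩
  · exact (Real.continuous_exp.comp (Real.continuous_rpow_const hα.le).neg).continuousOn
  · exact fun t ht =>
      (Real.contDiffAt_rpow_const_of_ne (ne_of_gt ht)).neg.exp.contDiffWithinAt
  · have hf : (fun t : ℝ => Real.exp (-(t ^ α))) ∈ rpowMulExpCone α := by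
      simpa using mul_rpow_mul_exp_mem_rpowMulExpCone α zero_le_one le_rfl
    obtain ⟨h, hm, hn⟩ := exists_iteratedDeriv_eq_of_mem_rpowMulExpCone hα.le hα1 hf n
    rw [hn t ht, ← mul_assoc, ← mul_pow, neg_one_mul, neg_neg, one_pow, one_mul]
    exact nonneg_of_mem_rpowMulExpCone hm ht
end

section
/- For every φ > 0, τ > 0 and α ∈ (0,1], the generalized Cauchy function f(t) = (1 + (t/φ)^α)^{−τ/α} is completely monotone on [0,∞): f is nonnegative and continuous on [0,∞), infinitely differentiable on (0,∞), and (−1)ⁿ f⁽ⁿ⁾(t) ≥ 0 for every integer n ≥ 0 and every t > 0. -/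
theorem one_add_mul_rpow_pos {k : ℝ} (hk : 0 ≤ k) (α : ℝ) {t : ℝ} (ht : 0 ≤ t) :
    0 < 1 + k * t ^ α := by
  have := mul_nonneg hk (Real.rpow_nonneg ht α)
  linarith

theorem contDiffAt_rpow_mul_one_add_mul_rpow {k : ℝ} (hk : 0 ≤ k) (a b α : ℝ) {t : ℝ}
    (ht : 0 < t) (n : WithTop ℕ∞) :
    ContDiffAt ℝ n (fun s : ℝ => s ^ a * (1 + k * s ^ α) ^ b) t :=
  (contDiffAt_id.rpow_const_of_ne ht.ne').mul
    ((contDiffAt_const.add (contDiffAt_const.mul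
      (contDiffAt_id.rpow_const_of_ne ht.ne'))).rpow_const_of_ne
        (one_add_mul_rpow_pos hk α ht.le).ne')

theorem deriv_rpow_mul_one_add_mul_rpow {k : ℝ} (hk : 0 ≤ k) (a b α : ℝ) {t : ℝ}
    (ht : 0 < t) :
    deriv (fun s : ℝ => s ^ a * (1 + k * s ^ α) ^ b) t =
      a * (t ^ (a - 1) * (1 + k * t ^ α) ^ b) +
        (b * k * α) * (t ^ (a + α - 1) * (1 + k * t ^ α) ^ (b - 1)) := by
  have h := (Real.hasDerivAt_rpow_const (p := a) (Or.inl ht.ne')).mul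
    ((((Real.hasDerivAt_rpow_const (p := α) (Or.inl ht.ne')).const_mul k).const_add 1).rpow_const
      (p := b) (Or.inl (one_add_mul_rpow_pos hk α ht.le).ne'))
  refine h.deriv.trans ?_
  rw [add_sub_assoc, Real.rpow_add ht]
  ring

/-- The derivatives of `t ↦ t ^ a * (1 + k * t ^ α) ^ b` alternate in sign: up to sign, its first
derivative is a nonnegative combination of functions of the same form. -/
theorem neg_one_pow_mul_iteratedDeriv_rpow_mul_nonneg {k α : ℝ} (hk : 0 ≤ k) (hα : 0 ≤ α)
    (hα1 : α ≤ 1) (n : ℕ) {a b t : ℝ} (ha : a ≤ 0) (hb : b ≤ 0) (ht : 0 < t) :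
    0 ≤ (-1 : ℝ) ^ n * iteratedDeriv n (fun s : ℝ => s ^ a * (1 + k * s ^ α) ^ b) t := by
  induction n generalizing a b with
  | zero =>
    have := one_add_mul_rpow_pos hk α ht.le
    simp only [pow_zero, iteratedDeriv_zero, one_mul]
    positivity
  | succ n ih =>
    have hderiv : Set.EqOn (deriv fun s : ℝ => s ^ a * (1 + k * s ^ α) ^ b)
        ((fun s => a * (s ^ (a - 1) * (1 + k * s ^ α) ^ b)) +
          fun s => (b * k * α) * (s ^ (a + α - 1) * (1 + k * s ^ α) ^ (b - 1))) (Set.Ioi 0) :=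
      fun s hs => deriv_rpow_mul_one_add_mul_rpow hk a b α hs
    rw [iteratedDeriv_succ', hderiv.iteratedDeriv_of_isOpen isOpen_Ioi n ht,
      iteratedDeriv_add
        (contDiffAt_const.mul (contDiffAt_rpow_mul_one_add_mul_rpow hk _ _ _ ht _))
        (contDiffAt_const.mul (contDiffAt_rpow_mul_one_add_mul_rpow hk _ _ _ ht _)),
      iteratedDeriv_const_mul_field, iteratedDeriv_const_mul_field]
    have h₁ := mul_nonneg (neg_nonneg.2 ha) (ih (a := a - 1) (b := b) (by linarith) hb)
    have h₂ := mul_nonneg (mul_nonneg (mul_nonneg (neg_nonneg.2 hb) hk) hα)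
      (ih (a := a + α - 1) (b := b - 1) (by linarith) (by linarith))
    rw [pow_succ]
    linarith

/-- For every `φ > 0`, `τ > 0` and `α ∈ (0,1]`, the generalized Cauchy function
`t ↦ (1 + (t/φ)^α)^(-τ/α)` is completely monotone on `[0,∞)`. -/
theorem stmt9 (φ τ α : ℝ) (hφ : 0 < φ) (hτ : 0 < τ) (hα : 0 < α) (hα1 : α ≤ 1) :
    CompletelyMonotone (fun t : ℝ => (1 + (t / φ) ^ α) ^ (-(τ / α))) := by
  have hk : 0 ≤ (φ ^ α)⁻¹ := by positivity
  have heq : Set.EqOn (fun t : ℝ => (1 + (t / φ) ^ α) ^ (-(τ / α)))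
      (fun t => t ^ (0 : ℝ) * (1 + (φ ^ α)⁻¹ * t ^ α) ^ (-(τ / α))) (Set.Ioi 0) := by
    intro t ht
    simp only [Real.rpow_zero, one_mul, Real.div_rpow (le_of_lt ht) hφ.le]
    rw [div_eq_inv_mul (t ^ α)]
  refine ⟨fun t ht => by positivity, ?_, ?_, fun n t ht => ?_⟩
  · refine ContinuousOn.rpow_const ?_ fun t ht => Or.inl ?_
    · exact (continuous_const.add
        ((continuous_id.div_const φ).rpow_const fun _ => Or.inr hα.le)).continuousOn
    · have : 0 ≤ t := ht
      positivity
  · exact ContDiffOn.congr (fun t ht =>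
      (contDiffAt_rpow_mul_one_add_mul_rpow hk _ _ _ ht _).contDiffWithinAt) heq
  · rw [heq.iteratedDeriv_of_isOpen isOpen_Ioi n ht]
    exact neg_one_pow_mul_iteratedDeriv_rpow_mul_nonneg hk hα.le hα1 n le_rfl
      (neg_nonpos.2 (by positivity)) ht
end

section
/- Let σ ≠ 0 and a, b ∈ ℝ, and consider the 3 × 3 real matrix M = [[σ², ab/σ², a], [ab/σ², σ², b], [a, b, σ²]]. If M is invertible, then the (1,2) entry (equivalently, by symmetry, the (2,1) entry) of M⁻¹ is zero. (This is the precision-matrix computation showing that a Gaussian process on a tree with exponential covariance c(u,v) = σ² exp(−s d(u,v)) satisfies the Markov property: for w on the path between u and v, where c(u,v) = c(u,w)c(w,v)/σ², the values Y(u) and Y(v) are conditionally independent given Y(w).) -/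
/-- For the 3 × 3 covariance matrix `M = [[σ², ab/σ², a], [ab/σ², σ², b], [a, b, σ²]]`
(the covariance of a Gaussian vector `(Y(u), Y(v), Y(w))` with `c(u,v) = c(u,w)c(w,v)/σ²`),
if `M` is invertible then the `(1,2)` entry of the precision matrix `M⁻¹` vanishes. -/
theorem stmt11 (σ a b : ℝ) (hσ : σ ≠ 0)
    (M : Matrix (Fin 3) (Fin 3) ℝ)
    (hM : M = !![σ ^ 2, a * b / σ ^ 2, a; a * b / σ ^ 2, σ ^ 2, b; a, b, σ ^ 2])
    (hinv : IsUnit M.det) :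
    M⁻¹ 0 1 = 0 := by
  have h_adj : M.adjugate 0 1 = 0 := by
    subst hM
    rw [Matrix.adjugate_fin_three]
    simp
    field_simp
    ring
  rw [Matrix.inv_def, Matrix.smul_apply, h_adj, smul_zero]
end

section
/- For every a > 0, the kernel k(x,y) = exp(−a|x − y|) − exp(−a(x + y)) is positive semidefinite on [0,∞): for every n, all points x₁,…,xₙ ∈ [0,∞), and all reals c₁,…,cₙ, one has ∑_{i,j=1}^n cᵢ cⱼ k(xᵢ, xⱼ) ≥ 0. -/
/-- The Brownian covariance `min` is a positive semidefinite kernel on `[0,∞)`. -/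
theorem sum_mul_mul_min_nonneg {ι : Type*} [Fintype ι] (u : ι → ℝ) (hu : ∀ i, 0 ≤ u i)
    (d : ι → ℝ) : 0 ≤ ∑ i, ∑ j, d i * d j * min (u i) (u j) := by
  have h := (MeasureTheory.posSemidef_matrix_measure_inter
    (μ := MeasureTheory.volume) (s := fun i ↦ Set.Icc 0 (u i))
    (fun _ ↦ measurableSet_Icc)
    (fun _ ↦ isCompact_Icc.measure_ne_top)).dotProduct_mulVec_nonneg d
  have hmin (i j : ι) : MeasureTheory.volume.real (Set.Icc 0 (u i) ∩ Set.Icc 0 (u j)) =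
      min (u i) (u j) := by
    simp [Set.Icc_inter_Icc, Real.volume_real_Icc, hu i, hu j]
  refine h.trans_eq ?_
  simp only [dotProduct, Matrix.mulVec, Matrix.of_apply, hmin, Finset.mul_sum, star_trivial]
  exact Finset.sum_congr rfl fun i _ ↦ Finset.sum_congr rfl fun j _ ↦ by ring

/-- The kernel is a rescaled, time-changed Brownian covariance. -/
theorem exp_neg_abs_sub_sub_exp_neg_add {a : ℝ} (ha : 0 < a) (x y : ℝ) :
    Real.exp (-(a * |x - y|)) - Real.exp (-(a * (x + y))) =
      Real.exp (-(a * x)) * Real.exp (-(a * y)) *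
        min (Real.exp (2 * a * x) - 1) (Real.exp (2 * a * y) - 1) := by
  wlog hxy : x ≤ y generalizing x y
  · rw [abs_sub_comm, add_comm x, this y x (le_of_not_ge hxy), min_comm]
    ring
  have hexp : Real.exp (2 * a * x) ≤ Real.exp (2 * a * y) := by gcongr
  rw [min_eq_left (by linarith), abs_of_nonpos (by linarith), mul_sub, mul_one,
    ← Real.exp_add, ← Real.exp_add]
  ring_nf

/-- For every `a > 0`, the kernel `k(x,y) = exp(-a|x-y|) - exp(-a(x+y))` is positive
semidefinite on `[0,∞)`. -/
theorem stmt12 (a : ℝ) (ha : 0 < a) (n : ℕ) (x : Fin n → ℝ) (hx : ∀ i, 0 ≤ x i)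
    (c : Fin n → ℝ) :
    0 ≤ ∑ i, ∑ j, c i * c j *
      (Real.exp (-(a * |x i - x j|)) - Real.exp (-(a * (x i + x j)))) := by
  refine (sum_mul_mul_min_nonneg (fun i ↦ Real.exp (2 * a * x i) - 1)
    (fun i ↦ sub_nonneg.2 <| Real.one_le_exp <| mul_nonneg (by positivity) (hx i))
    (fun i ↦ c i * Real.exp (-(a * x i)))).trans_eq ?_
  refine Finset.sum_congr rfl fun i _ ↦ Finset.sum_congr rfl fun j _ ↦ ?_
  rw [exp_neg_abs_sub_sub_exp_neg_add ha]
  ring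
end

section
/- Let n ≥ 1, let C be a real symmetric positive semidefinite n × n matrix, and let Y = μ + A Z, where A is a real n × n matrix with A Aᵀ = C, Z = (Z₁,…,Zₙ) are independent standard Gaussian random variables, and μᵢ = −C_{ii}/2 for each i. Then E[∏_{i=1}^n exp(Yᵢ)] = exp(∑_{1 ≤ i < j ≤ n} C_{ij}). (This is the formula ρ(u₁,…,uₙ) = ρ(u₁)⋯ρ(uₙ) exp(∑_{i<j} c(uᵢ,uⱼ)) for the n-th order intensity function of a log Gaussian Cox process.) -/
open MeasureTheory ProbabilityTheory

/-- The moment generating function of the standard Gaussian vector. -/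
theorem integral_exp_sum_mul_pi_gaussianReal {ι : Type*} [Fintype ι] (b : ι → ℝ) :
    ∫ z : ι → ℝ, Real.exp (∑ j, b j * z j) ∂(Measure.pi fun _ : ι => gaussianReal 0 1)
      = Real.exp (∑ j, b j ^ 2 / 2) := by
  simp_rw [Real.exp_sum]
  rw [integral_fintype_prod_eq_prod (fun j x => Real.exp (b j * x))]
  refine Finset.prod_congr rfl fun j _ => ?_
  simpa [mgf] using congrFun (mgf_id_gaussianReal (μ := 0) (v := 1)) (b j)

/-- The entries of a symmetric matrix sum to the trace plus twice the strict upper triangle. -/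
theorem Matrix.IsSymm.sum_sum_eq {ι R : Type*} [Fintype ι] [LinearOrder ι]
    [LocallyFiniteOrder ι] [LocallyFiniteOrderTop ι] [LocallyFiniteOrderBot ι]
    [CommSemiring R] {C : Matrix ι ι R} (hC : C.IsSymm) :
    ∑ i, ∑ j, C i j = ∑ i, C i i + 2 * ∑ i, ∑ j ∈ Finset.Ioi i, C i j := by
  have h := Finset.sum_sum_Ioi_add_eq_sum_sum_off_diag (fun i j => C i j)
  simp_rw [hC.apply, ← two_mul, ← Finset.mul_sum] at h
  rw [h, ← Finset.sum_add_distrib]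
  exact Finset.sum_congr rfl fun i _ => Fintype.sum_eq_add_sum_compl i _

/-- The squared column sums of `A` add up to the sum of the entries of `A * Aᵀ`. -/
theorem Matrix.sum_sq_col_sum {m n R : Type*} [Fintype m] [Fintype n] [CommSemiring R]
    (A : Matrix m n R) :
    ∑ j, (∑ i, A i j) ^ 2 = ∑ i, ∑ k, (A * A.transpose) i k := by
  simp_rw [sq, Finset.sum_mul_sum, Matrix.mul_apply, Matrix.transpose_apply]
  rw [Finset.sum_comm]
  exact Finset.sum_congr rfl fun i _ => Finset.sum_comm

/-- For a centered Gaussian vector `Y = μ + AZ` with covariance `C = AAᵀ`, independent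
standard Gaussians `Z` (modelled by the product of standard Gaussian measures), and
`μᵢ = -Cᵢᵢ/2`, one has `E[∏ᵢ exp(Yᵢ)] = exp(∑_{i<j} Cᵢⱼ)`: the n-th order intensity
formula of a log Gaussian Cox process. -/
theorem stmt14 (n : ℕ) (hn : 1 ≤ n)
    (C A : Matrix (Fin n) (Fin n) ℝ)
    (hC : C.PosSemidef) (hA : A * A.transpose = C) :
    ∫ z : Fin n → ℝ,
        ∏ i, Real.exp (-(C i i) / 2 + ∑ j, A i j * z j)
        ∂(Measure.pi fun _ : Fin n => gaussianReal 0 1)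
      = Real.exp (∑ i, ∑ j ∈ Finset.Ioi i, C i j) := by
  have hsymm : C.IsSymm := by rw [← hA]; exact Matrix.isSymm_mul_transpose_self A
  have hprod : ∀ z : Fin n → ℝ, ∏ i, Real.exp (-(C i i) / 2 + ∑ j, A i j * z j)
      = Real.exp (∑ i, -(C i i) / 2) * Real.exp (∑ j, (∑ i, A i j) * z j) := by
    intro z
    rw [← Real.exp_sum, Finset.sum_add_distrib, Real.exp_add, Finset.sum_comm]
    simp_rw [Finset.sum_mul]
  simp_rw [hprod]
  rw [integral_const_mul, integral_exp_sum_mul_pi_gaussianReal, ← Real.exp_add,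
    ← Finset.sum_div, ← Finset.sum_div, Matrix.sum_sq_col_sum, hA, hsymm.sum_sum_eq,
    Finset.sum_neg_distrib]
  congr 1
  ring
end

section
/- Let Y = (Y₁,…,Yₙ) = A Z be a centered Gaussian random vector, where A is a real n × m matrix and Z = (Z₁,…,Z_m) are independent standard Gaussian random variables. Then for every subset I ⊆ {1,…,n}, E[exp(−∑_{i=1}^n Yᵢ²)] ≥ E[exp(−∑_{i ∈ I} Yᵢ²)] · E[exp(−∑_{i ∉ I} Yᵢ²)]. (This inequality shows that the interrupted Cox process is positively correlated at all orders: its n-th order intensity satisfies ρ(u₁,…,uₙ) ≥ ρ(u₁,…,u_k) ρ(u_{k+1},…,uₙ).) -/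
open MeasureTheory ProbabilityTheory

/-- The standard Gaussian measure on `κ → ℝ`, as a product of standard Gaussian measures. -/
noncomputable abbrev stdGaussianPi (κ : Type*) [Fintype κ] : Measure (κ → ℝ) :=
  Measure.pi fun _ : κ => gaussianReal 0 1

section

variable {ι ι' κ : Type*} [Fintype ι] [Fintype ι'] [Fintype κ]

lemma integral_cexp_sqrt_two_mul_dotProduct (x : κ → ℝ) :
    ∫ z, Complex.exp ((√2 * (z ⬝ᵥ x) : ℝ) * Complex.I) ∂(stdGaussianPi κ)
      = (Real.exp (-(x ⬝ᵥ x)) : ℝ) := by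
  have h1 (z : κ → ℝ) : Complex.exp ((√2 * (z ⬝ᵥ x) : ℝ) * Complex.I)
      = ∏ j, Complex.exp ((√2 * x j : ℝ) * (z j : ℝ) * Complex.I) := by
    rw [← Complex.exp_sum, ← Finset.sum_mul]
    congr 2
    simp only [dotProduct, Finset.mul_sum]
    push_cast
    exact Finset.sum_congr rfl fun j _ => by ring
  have h2 (t : ℝ) : ∫ y, Complex.exp ((√2 * t : ℝ) * (y : ℝ) * Complex.I) ∂(gaussianReal 0 1)
      = Complex.exp ((-(t * t) : ℝ)) := by
    rw [← charFun_apply_real, charFun_gaussianReal]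
    congr 1
    have : ((√2 : ℝ) : ℂ) ^ 2 = 2 := by
      rw [← Complex.ofReal_pow, Real.sq_sqrt (by norm_num)]
      norm_num
    push_cast
    rw [mul_pow, this]
    ring
  simp_rw [h1]
  rw [integral_fintype_prod_eq_prod (𝕜 := ℂ)
    (fun j (y : ℝ) => Complex.exp ((√2 * x j : ℝ) * (y : ℝ) * Complex.I))]
  simp_rw [h2]
  rw [← Complex.exp_sum, Complex.ofReal_exp]
  simp [dotProduct]

/-- `E[exp(-|X|²)]` is the average of the characteristic function of `X` at `√2 Z`, with `Z`
a standard Gaussian vector. -/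
lemma integral_exp_neg_dotProduct_self {Ω : Type*} [MeasurableSpace Ω] (μ : Measure Ω)
    [IsFiniteMeasure μ] {X : Ω → κ → ℝ} (hX : Measurable X) :
    ((∫ ω, Real.exp (-(X ω ⬝ᵥ X ω)) ∂μ : ℝ) : ℂ)
      = ∫ z, ∫ ω, Complex.exp ((√2 * (z ⬝ᵥ X ω) : ℝ) * Complex.I) ∂μ ∂(stdGaussianPi κ) := by
  rw [← integral_complex_ofReal]
  simp_rw [← integral_cexp_sqrt_two_mul_dotProduct]
  refine integral_integral_swap (f := fun ω z =>
    Complex.exp ((√2 * (z ⬝ᵥ X ω) : ℝ) * Complex.I)) ?_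
  refine Integrable.of_bound (C := 1) ?_ ?_
  · refine Measurable.aestronglyMeasurable ?_
    simp only [Function.uncurry_def, dotProduct]
    have hj (j : κ) : Measurable fun p : Ω × (κ → ℝ) => X p.1 j :=
      (measurable_pi_apply j).comp (hX.comp measurable_fst)
    fun_prop
  · refine .of_forall fun p => ?_
    simp only [Function.uncurry_def]
    rw [Complex.norm_exp_ofReal_mul_I]

open Matrix in
lemma integral_exp_neg_mulVec_eq_vecMul (B : Matrix ι κ ℝ) :
    ∫ z, Real.exp (-(B *ᵥ z ⬝ᵥ B *ᵥ z)) ∂(stdGaussianPi κ)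
      = ∫ w, Real.exp (-(w ᵥ* B ⬝ᵥ w ᵥ* B)) ∂(stdGaussianPi ι) := by
  apply Complex.ofReal_injective
  rw [integral_exp_neg_dotProduct_self _ (X := fun w => w ᵥ* B)
    (by fun_prop), ← integral_complex_ofReal]
  refine integral_congr_ae (.of_forall fun z => ?_)
  simp only
  simp_rw [dotProduct_comm z, ← dotProduct_mulVec, integral_cexp_sqrt_two_mul_dotProduct]

open Matrix in
lemma integral_exp_neg_mulVec_add_eq_vecMul (B : Matrix ι κ ℝ) (C : Matrix ι' κ ℝ) :
    ∫ z, Real.exp (-(B *ᵥ z ⬝ᵥ B *ᵥ z + C *ᵥ z ⬝ᵥ C *ᵥ z)) ∂(stdGaussianPi κ)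
      = ∫ p, Real.exp (-((p.1 ᵥ* B + p.2 ᵥ* C) ⬝ᵥ (p.1 ᵥ* B + p.2 ᵥ* C)))
          ∂((stdGaussianPi ι).prod (stdGaussianPi ι')) := by
  apply Complex.ofReal_injective
  rw [integral_exp_neg_dotProduct_self _
    (X := fun p : (ι → ℝ) × (ι' → ℝ) => p.1 ᵥ* B + p.2 ᵥ* C)
    (by fun_prop), ← integral_complex_ofReal]
  refine integral_congr_ae (.of_forall fun z => ?_)
  simp only
  simp_rw [dotProduct_comm z, add_dotProduct, ← dotProduct_mulVec, mul_add, Complex.ofReal_add,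
    add_mul, Complex.exp_add]
  rw [integral_prod_mul (fun w : ι → ℝ => Complex.exp ((√2 * (w ⬝ᵥ B *ᵥ z) : ℝ) * Complex.I))
    (fun w : ι' → ℝ => Complex.exp ((√2 * (w ⬝ᵥ C *ᵥ z) : ℝ) * Complex.I)),
    integral_cexp_sqrt_two_mul_dotProduct, integral_cexp_sqrt_two_mul_dotProduct,
    neg_add, Real.exp_add, Complex.ofReal_mul]

lemma measurePreserving_neg_stdGaussianPi :
    MeasurePreserving (fun w : ι → ℝ => -w) (stdGaussianPi ι) (stdGaussianPi ι) :=
  measurePreserving_pi _ _ fun _ => ⟨measurable_neg,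
    (gaussianReal_map_neg (μ := 0) (v := 1)).trans (by rw [neg_zero])⟩

lemma integrable_exp_neg_dotProduct_self {Ω : Type*} [MeasurableSpace Ω] (μ : Measure Ω)
    [IsFiniteMeasure μ] {X : Ω → κ → ℝ} (hX : Measurable X) :
    Integrable (fun ω => Real.exp (-(X ω ⬝ᵥ X ω))) μ := by
  refine Integrable.of_bound (C := 1) ?_ (.of_forall fun ω => ?_)
  · refine Measurable.aestronglyMeasurable ?_
    simp only [dotProduct]
    fun_prop
  · rw [Real.norm_eq_abs, Real.abs_exp, Real.exp_le_one_iff, neg_nonpos]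
    exact Finset.sum_nonneg fun j _ => mul_self_nonneg _

lemma two_mul_exp_mul_exp_le (a b : κ → ℝ) :
    2 * (Real.exp (-(a ⬝ᵥ a)) * Real.exp (-(b ⬝ᵥ b)))
      ≤ Real.exp (-((a + b) ⬝ᵥ (a + b))) + Real.exp (-((a + -b) ⬝ᵥ (a + -b))) := by
  have h1 : -((a + b) ⬝ᵥ (a + b)) = -(a ⬝ᵥ a) + -(b ⬝ᵥ b) + -(2 * (a ⬝ᵥ b)) := by
    simp only [add_dotProduct, dotProduct_add, dotProduct_comm b a]
    ring
  have h2 : -((a + -b) ⬝ᵥ (a + -b)) = -(a ⬝ᵥ a) + -(b ⬝ᵥ b) + 2 * (a ⬝ᵥ b) := by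
    simp only [add_dotProduct, dotProduct_add, dotProduct_neg, neg_dotProduct,
      dotProduct_comm b a]
    ring
  rw [h1, h2, Real.exp_add _ (-(2 * _)), Real.exp_add _ (2 * _), Real.exp_add, ← mul_add]
  have h3 := Real.one_le_cosh (2 * (a ⬝ᵥ b))
  rw [Real.cosh_eq] at h3
  rw [mul_comm]
  exact mul_le_mul_of_nonneg_left (by linarith) (by positivity)

open Matrix in
/-- `E[exp(-|BZ|²)] E[exp(-|CZ|²)] ≤ E[exp(-|BZ|² - |CZ|²)]` for a standard Gaussian `Z`. -/
theorem integral_exp_neg_mulVec_mul_le (B : Matrix ι κ ℝ) (C : Matrix ι' κ ℝ) :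
    (∫ z, Real.exp (-(B *ᵥ z ⬝ᵥ B *ᵥ z)) ∂(stdGaussianPi κ)) *
      (∫ z, Real.exp (-(C *ᵥ z ⬝ᵥ C *ᵥ z)) ∂(stdGaussianPi κ))
      ≤ ∫ z, Real.exp (-(B *ᵥ z ⬝ᵥ B *ᵥ z + C *ᵥ z ⬝ᵥ C *ᵥ z)) ∂(stdGaussianPi κ) := by
  rw [integral_exp_neg_mulVec_eq_vecMul, integral_exp_neg_mulVec_eq_vecMul,
    integral_exp_neg_mulVec_add_eq_vecMul, ← integral_prod_mul]
  set μ := (stdGaussianPi ι).prod (stdGaussianPi ι') with hμ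
  let F : (ι → ℝ) × (ι' → ℝ) → ℝ := fun p =>
    Real.exp (-((p.1 ᵥ* B + p.2 ᵥ* C) ⬝ᵥ (p.1 ᵥ* B + p.2 ᵥ* C)))
  have hF : Integrable F μ := integrable_exp_neg_dotProduct_self μ
    (X := fun p : (ι → ℝ) × (ι' → ℝ) => p.1 ᵥ* B + p.2 ᵥ* C) (by fun_prop)
  have hflip : MeasurePreserving (Prod.map id fun w : ι' → ℝ => -w) μ μ :=
    (MeasurePreserving.id _).prod measurePreserving_neg_stdGaussianPi
  have hF' : Integrable (fun p => F (Prod.map id (fun w : ι' → ℝ => -w) p)) μ :=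
    hflip.integrable_comp_of_integrable hF
  have hsymm : ∫ p, F (Prod.map id (fun w : ι' → ℝ => -w) p) ∂μ = ∫ p, F p ∂μ := by
    rw [← integral_map hflip.measurable.aemeasurable
      (by rw [hflip.map_eq]; exact hF.aestronglyMeasurable), hflip.map_eq]
  have hG : Integrable (fun p : (ι → ℝ) × (ι' → ℝ) =>
      Real.exp (-(p.1 ᵥ* B ⬝ᵥ p.1 ᵥ* B)) * Real.exp (-(p.2 ᵥ* C ⬝ᵥ p.2 ᵥ* C))) μ :=
    (integrable_exp_neg_dotProduct_self (stdGaussianPi ι) (X := fun w => w ᵥ* B)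
      (by fun_prop)).mul_prod
      (integrable_exp_neg_dotProduct_self (stdGaussianPi ι') (X := fun w => w ᵥ* C) (by fun_prop))
  have key := integral_mono (hG.const_mul 2) (hF.add hF') fun p => by
    simp only [F, Pi.add_apply, Prod.map_fst, Prod.map_snd, id, neg_vecMul]
    exact two_mul_exp_mul_exp_le (p.1 ᵥ* B) (p.2 ᵥ* C)
  simp only [Pi.add_apply] at key
  rw [integral_const_mul, integral_add hF hF', hsymm] at key
  change _ ≤ ∫ p, F p ∂μ
  linarith

end

/-- For a centered Gaussian vector `Y = AZ` (with `Z` independent standard Gaussians,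
modelled by the product of standard Gaussian measures) and any subset `I` of the indices,
`E[exp(-∑ᵢ Yᵢ²)] ≥ E[exp(-∑_{i∈I} Yᵢ²)] ⋅ E[exp(-∑_{i∉I} Yᵢ²)]`: the inequality showing
that the interrupted Cox process is positively correlated at all orders. -/
theorem stmt18 (n m : ℕ) (A : Matrix (Fin n) (Fin m) ℝ) (I : Finset (Fin n)) :
    (∫ z : Fin m → ℝ, Real.exp (-∑ i ∈ I, (A.mulVec z i) ^ 2)
        ∂(Measure.pi fun _ : Fin m => gaussianReal 0 1)) *
      (∫ z : Fin m → ℝ, Real.exp (-∑ i ∈ Iᶜ, (A.mulVec z i) ^ 2)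
        ∂(Measure.pi fun _ : Fin m => gaussianReal 0 1))
      ≤ ∫ z : Fin m → ℝ, Real.exp (-∑ i, (A.mulVec z i) ^ 2)
        ∂(Measure.pi fun _ : Fin m => gaussianReal 0 1) := by
  have hsub (S : Finset (Fin n)) (z : Fin m → ℝ) :
      (A.submatrix (Subtype.val : S → Fin n) id).mulVec z ⬝ᵥ
        (A.submatrix (Subtype.val : S → Fin n) id).mulVec z = ∑ i ∈ S, (A.mulVec z i) ^ 2 := by
    rw [← Finset.sum_coe_sort]
    exact Finset.sum_congr rfl fun i _ => (sq _).symm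
  simpa only [hsub, Finset.sum_add_sum_compl] using integral_exp_neg_mulVec_mul_le
    (A.submatrix (Subtype.val : I → Fin n) id)
    (A.submatrix (Subtype.val : (Iᶜ : Finset (Fin n)) → Fin n) id)
end
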